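/- Fix positive integers k_1, k_2. For every ε > 0 there exists a constant C = C(k_1,k_2,ε) > 0 such that for every prime p, all intervals I_1, I_2 ⊂ F_p not containing 0, of cardinalities N_1 and N_2 respectively (in arbitrary position), satisfying N_1 < p^{(k_1+1)/(2k_1)} and N_2 < p^{(k_2+1)/(2k_2)}, all complex coefficients α_1(x_1), α_2(x_2) with |α_1(x_1)| ≤ 1 and |α_2(x_2)| ≤ 1, and every a ∈ F_p with a ≠ 0, one has |∑_{x_1∈I_1} ∑_{x_2∈I_2} α_1(x_1) α_2(x_2) e_p(a x_1^{-1} x_2^{-1})| ≤ C·p^{1/(2k_1k_2)}·N_1^{−1/(k_2(k_1+1))}·N_2^{−1/(k_1(k_2+1))}·(N_1 N_2)^{1+ε}. -/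

import Mathlib

open Finset

/-- The interval `{a+1, a+2, …, a+N}` in `ZMod p`. -/
def interval (p : ℕ) (a : ZMod p) (N : ℕ) : Finset (ZMod p) :=
  (Finset.Icc 1 N).image (fun i : ℕ => a + (i : ZMod p))

/-- `e_p(z) = exp(2πi z/p)` for `z ∈ ZMod p`. -/
noncomputable def ep (p : ℕ) (z : ZMod p) : ℂ :=
  Complex.exp (2 * (Real.pi : ℂ) * Complex.I * (z.val : ℂ) / (p : ℂ))

section Fourier

variable {p : ℕ} [NeZero p]

/-- The exponential sum `∑ f(x) e_p(μ x⁻¹)` over `ZMod p`. -/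
noncomputable def recipSum (f : ZMod p → ℂ) (μ : ZMod p) : ℂ :=
  ∑ x, f x * ZMod.stdAddChar (μ * x⁻¹)

/-- The weighted number of representations of `z` as a sum of `k` reciprocals. -/
noncomputable def recipRep (k : ℕ) (f : ZMod p → ℂ) (z : ZMod p) : ℂ :=
  ∑ x : Fin k → ZMod p with ∑ i, (x i)⁻¹ = z, ∏ i, f (x i)

/-- The weighted number of solutions of
`x₁⁻¹ + ⋯ + xₖ⁻¹ = y₁⁻¹ + ⋯ + yₖ⁻¹`. -/
noncomputable def recipEnergy (k : ℕ) (f : ZMod p → ℂ) : ℝ :=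
  ∑ z, ‖recipRep k f z‖ ^ 2

lemma ep_eq_stdAddChar (z : ZMod p) : ep p z = ZMod.stdAddChar z := by
  rw [ZMod.stdAddChar_apply, ZMod.toCircle_apply, ep]

lemma stdAddChar_sum {ι : Type*} (s : Finset ι) (f : ι → ZMod p) :
    ZMod.stdAddChar (∑ i ∈ s, f i) = ∏ i ∈ s, ZMod.stdAddChar (f i) :=
  map_prod (ZMod.stdAddChar (N := p)).toMonoidHom (fun i => Multiplicative.ofAdd (f i)) s

lemma recipEnergy_nonneg (k : ℕ) (f : ZMod p → ℂ) : 0 ≤ recipEnergy k f :=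
  Finset.sum_nonneg fun _ _ => by positivity

lemma recipSum_pow (k : ℕ) (f : ZMod p → ℂ) (μ : ZMod p) :
    recipSum f μ ^ k = ∑ z, recipRep k f z * ZMod.stdAddChar (μ * z) := by
  have h : ∀ z : ZMod p, recipRep k f z * ZMod.stdAddChar (μ * z) =
      ∑ x : Fin k → ZMod p with ∑ i, (x i)⁻¹ = z,
        ∏ i, (f (x i) * ZMod.stdAddChar (μ * (x i)⁻¹)) := by
    intro z
    rw [recipRep, Finset.sum_mul]
    refine Finset.sum_congr rfl fun x hx => ?_
    rw [← (Finset.mem_filter.1 hx).2, Finset.prod_mul_distrib, Finset.mul_sum,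
      stdAddChar_sum]
  simp_rw [h]
  rw [recipSum, Finset.sum_pow', Finset.sum_fiberwise]
  simp

lemma sum_norm_sq_fourier (r : ZMod p → ℂ) :
    ∑ μ : ZMod p, ‖∑ z, r z * ZMod.stdAddChar (μ * z)‖ ^ 2 = p * ∑ z, ‖r z‖ ^ 2 := by
  have key : (∑ μ : ZMod p, (∑ z, r z * ZMod.stdAddChar (μ * z)) *
      (starRingEnd ℂ) (∑ z, r z * ZMod.stdAddChar (μ * z))) =
      p * ∑ z, r z * (starRingEnd ℂ) (r z) := by
    have h1 : ∀ μ : ZMod p, (∑ z, r z * ZMod.stdAddChar (μ * z)) *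
        (starRingEnd ℂ) (∑ z, r z * ZMod.stdAddChar (μ * z)) =
        ∑ z, ∑ w, r z * (starRingEnd ℂ) (r w) * ZMod.stdAddChar (μ * (z - w)) := by
      intro μ
      rw [map_sum, Finset.sum_mul_sum]
      refine Finset.sum_congr rfl fun z _ => Finset.sum_congr rfl fun w _ => ?_
      rw [RingHom.map_mul, ← AddChar.map_neg_eq_conj, mul_sub, sub_eq_add_neg,
        AddChar.map_add_eq_mul]
      ring
    simp_rw [h1]
    rw [Finset.sum_comm, Finset.mul_sum]
    refine Finset.sum_congr rfl fun z _ => ?_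
    rw [Finset.sum_comm]
    simp_rw [← Finset.mul_sum, AddChar.sum_mulShift _ (ZMod.isPrimitive_stdAddChar p), sub_eq_zero]
    simp
    ring
  simp_rw [Complex.mul_conj, Complex.normSq_eq_norm_sq] at key
  exact_mod_cast key

lemma sum_norm_recipSum_pow (k : ℕ) (f : ZMod p → ℂ) :
    ∑ μ, ‖recipSum f μ‖ ^ (2 * k) = p * recipEnergy k f := by
  rw [recipEnergy, ← sum_norm_sq_fourier]
  refine Finset.sum_congr rfl fun μ _ => ?_
  rw [← recipSum_pow, norm_pow, ← pow_mul, mul_comm]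

lemma norm_recipRep_le {f : ZMod p → ℂ} {g : ZMod p → ℝ} (h : ∀ x, ‖f x‖ ≤ g x) (k : ℕ)
    (z : ZMod p) : ‖recipRep k f z‖ ≤ ‖recipRep k (fun x => (g x : ℂ)) z‖ := by
  have e : recipRep k (fun x => (g x : ℂ)) z =
      ((∑ x : Fin k → ZMod p with ∑ i, (x i)⁻¹ = z, ∏ i, g (x i) : ℝ) : ℂ) := by
    rw [recipRep]; push_cast; rfl
  rw [e, Complex.norm_real]
  refine le_trans ?_ (le_abs_self _)
  refine (norm_sum_le _ _).trans (Finset.sum_le_sum fun x _ => ?_)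
  rw [norm_prod]
  exact Finset.prod_le_prod (fun _ _ => norm_nonneg _) fun i _ => h _

lemma recipEnergy_mono {f : ZMod p → ℂ} {g : ZMod p → ℝ} (h : ∀ x, ‖f x‖ ≤ g x) (k : ℕ) :
    recipEnergy k f ≤ recipEnergy k (fun x => (g x : ℂ)) :=
  Finset.sum_le_sum fun z _ => pow_le_pow_left₀ (norm_nonneg _) (norm_recipRep_le h k z) 2

lemma recipEnergy_const_mul (k : ℕ) (c : ℂ) (f : ZMod p → ℂ) :
    recipEnergy k (fun x => c * f x) = ‖c‖ ^ (2 * k) * recipEnergy k f := by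
  have h : ∀ z, recipRep k (fun x => c * f x) z = c ^ k * recipRep k f z := fun z => by
    simp [recipRep, Finset.mul_sum, Finset.prod_mul_distrib]
  simp_rw [recipEnergy, h, norm_mul, mul_pow, Finset.mul_sum, norm_pow, ← pow_mul, mul_comm k 2]

lemma recipEnergy_sum_le {ι : Type*} {k : ℕ} (hk : 0 < k) (S : Finset ι)
    (f : ι → ZMod p → ℂ) :
    recipEnergy k (fun x => ∑ i ∈ S, f i x) ≤
      (∑ i ∈ S, recipEnergy k (f i) ^ ((1 : ℝ) / (2 * k : ℕ))) ^ (2 * k) := by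
  have hp : (0 : ℝ) < p := by exact_mod_cast Nat.pos_of_ne_zero (NeZero.ne p)
  have h2k : 2 * k ≠ 0 := by omega
  let q : ENNReal := (2 * k : ℕ)
  have hq : q.toReal = (2 * k : ℕ) := ENNReal.toReal_natCast _
  have : Fact (1 ≤ q) := ⟨by
    have h : 1 ≤ 2 * k := by omega
    show (1 : ENNReal) ≤ ((2 * k : ℕ) : ENNReal)
    exact_mod_cast h⟩
  let T : (ZMod p → ℂ) → PiLp q (fun _ : ZMod p => ℂ) := fun g => WithLp.toLp q (recipSum g)
  have hT : ∀ g, ‖T g‖ = (p : ℝ) ^ ((1 : ℝ) / (2 * k : ℕ)) *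
      recipEnergy k g ^ ((1 : ℝ) / (2 * k : ℕ)) := by
    intro g
    rw [PiLp.norm_eq_sum (by rw [hq]; positivity), hq]
    simp_rw [Real.rpow_natCast]
    rw [← Real.mul_rpow hp.le (recipEnergy_nonneg k g), ← sum_norm_recipSum_pow]
  have hsum : T (fun x => ∑ i ∈ S, f i x) = ∑ i ∈ S, T (f i) := by
    ext μ
    rw [WithLp.ofLp_sum]
    simp only [T, recipSum, Finset.sum_mul, Finset.sum_apply]
    rw [Finset.sum_comm]
  have h := norm_sum_le S (fun i => T (f i))
  rw [← hsum] at h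
  simp_rw [hT, ← Finset.mul_sum] at h
  have h' := le_of_mul_le_mul_left h (by positivity)
  have h0 := recipEnergy_nonneg k (fun x => ∑ i ∈ S, f i x)
  have h'' := pow_le_pow_left₀ (by positivity) h' (2 * k)
  rwa [← Real.rpow_natCast, ← Real.rpow_mul (recipEnergy_nonneg _ _), one_div_mul_cancel
    (by exact_mod_cast h2k), Real.rpow_one] at h''

end Fourier

/-- A mixed Hölder inequality, with exponents `1 - 1/k`, `1/(2k)` and `1/(2k)`. -/
lemma sum_mul_pow_le {ι : Type*} (S : Finset ι) (a b : ι → ℝ) (ha : ∀ i, 0 ≤ a i)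
    (hb : ∀ i, 0 ≤ b i) {k : ℕ} (hk : 0 < k) :
    (∑ i ∈ S, a i * b i) ^ (2 * k) ≤
      (∑ i ∈ S, a i) ^ (2 * k - 2) * (∑ i ∈ S, a i ^ 2) * ∑ i ∈ S, b i ^ (2 * k) := by
  have hk' : (k : ℝ) ≠ 0 := by positivity
  have hA : 0 ≤ ∑ i ∈ S, a i := Finset.sum_nonneg fun i _ => ha i
  have hAB : 0 ≤ ∑ i ∈ S, a i * b i ^ k :=
    Finset.sum_nonneg fun i _ => mul_nonneg (ha i) (pow_nonneg (hb i) k)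
  have h1 : (∑ i ∈ S, a i * b i) ^ k ≤ (∑ i ∈ S, a i) ^ (k - 1) * ∑ i ∈ S, a i * b i ^ k := by
    have h := Real.inner_le_weight_mul_Lp_of_nonneg S (p := k) (by exact_mod_cast hk) a b ha hb
    have h' := pow_le_pow_left₀ (Finset.sum_nonneg fun i _ => mul_nonneg (ha i) (hb i)) h k
    simp_rw [Real.rpow_natCast] at h'
    refine h'.trans (le_of_eq ?_)
    rw [mul_pow, ← Real.rpow_natCast, ← Real.rpow_natCast (_ ^ _), ← Real.rpow_mul hA,
      ← Real.rpow_mul hAB, inv_mul_cancel₀ hk', Real.rpow_one, sub_mul, inv_mul_cancel₀ hk',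
      one_mul, ← Real.rpow_natCast, Nat.cast_sub hk, Nat.cast_one]
  have h2 : (∑ i ∈ S, a i * b i ^ k) ^ 2 ≤ (∑ i ∈ S, a i ^ 2) * ∑ i ∈ S, b i ^ (2 * k) := by
    simpa [← pow_mul, mul_comm k 2] using Finset.sum_mul_sq_le_sq_mul_sq S a (fun i => b i ^ k)
  calc (∑ i ∈ S, a i * b i) ^ (2 * k) = ((∑ i ∈ S, a i * b i) ^ k) ^ 2 := by
        rw [← pow_mul, mul_comm]
    _ ≤ ((∑ i ∈ S, a i) ^ (k - 1) * ∑ i ∈ S, a i * b i ^ k) ^ 2 :=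
        pow_le_pow_left₀ (pow_nonneg (Finset.sum_nonneg fun i _ => mul_nonneg (ha i) (hb i)) _) h1 2
    _ = (∑ i ∈ S, a i) ^ (2 * k - 2) * (∑ i ∈ S, a i * b i ^ k) ^ 2 := by
        rw [mul_pow, ← pow_mul]; congr 2; omega
    _ ≤ _ := by
        rw [mul_assoc]
        exact mul_le_mul_of_nonneg_left h2 (by positivity)

section Counting

variable {p : ℕ} [Fact p.Prime]

lemma recipEnergy_dilate (k : ℕ) (f : ZMod p → ℂ) {c : ZMod p} (hc : c ≠ 0) :
    recipEnergy k (fun x => f (c * x)) = recipEnergy k f := by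
  have h : ∀ z, recipRep k (fun x => f (c * x)) z = recipRep k f (c⁻¹ * z) := by
    intro z
    refine Finset.sum_equiv (Equiv.piCongrRight fun _ => Equiv.mulLeft₀ c hc) (fun x => ?_)
      (fun x _ => by simp)
    have : (∑ i, (c * x i)⁻¹) = c⁻¹ * ∑ i, (x i)⁻¹ := by
      rw [Finset.mul_sum]; exact Finset.sum_congr rfl fun i _ => by rw [mul_inv]
    simp only [Finset.mem_filter, Finset.mem_univ, true_and, Equiv.piCongrRight_apply,
      Pi.map_apply, Equiv.mulLeft₀_apply, this]
    exact (mul_right_injective₀ (inv_ne_zero hc)).eq_iff.symm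
  simp_rw [recipEnergy, h]
  exact Fintype.sum_equiv (Equiv.mulLeft₀ c⁻¹ (inv_ne_zero hc)) _ _ fun _ => rfl

lemma recipEnergy_indicator (k : ℕ) (B : Finset (ZMod p)) :
    recipEnergy k (fun x => if x ∈ B then 1 else 0) =
      #{v : (Fin k → ZMod p) × (Fin k → ZMod p) | (∀ i, v.1 i ∈ B) ∧ (∀ i, v.2 i ∈ B) ∧
        ∑ i, (v.1 i)⁻¹ = ∑ i, (v.2 i)⁻¹} := by
  have h : ∀ z, recipRep k (fun x => if x ∈ B then 1 else 0) z =
      (#{x : Fin k → ZMod p | (∀ i, x i ∈ B) ∧ ∑ i, (x i)⁻¹ = z} : ℂ) := by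
    intro z
    rw [recipRep, Finset.card_filter, Finset.sum_filter]
    push_cast
    refine Finset.sum_congr rfl fun x _ => ?_
    by_cases h1 : ∀ i, x i ∈ B
    · simp [h1]
    · obtain ⟨i, hi⟩ := not_forall.1 h1
      have h0 : (∏ i, if x i ∈ B then (1 : ℂ) else 0) = 0 :=
        Finset.prod_eq_zero (Finset.mem_univ i) (if_neg hi)
      simp [h1, h0]
  simp_rw [recipEnergy, h]
  rw [Finset.card_eq_sum_card_fiberwise (f := fun v => ∑ i, (v.1 i)⁻¹) (t := Finset.univ)
    (fun _ _ => Finset.mem_coe.2 (Finset.mem_univ _))]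
  push_cast
  refine Finset.sum_congr rfl fun z _ => ?_
  rw [Complex.norm_natCast, sq, ← Nat.cast_mul, ← Finset.card_product]
  congr 2
  ext v
  simp only [Finset.mem_product, Finset.mem_filter, Finset.mem_univ, true_and]
  constructor
  · rintro ⟨⟨h1, h2⟩, h3, h4⟩
    exact ⟨⟨h1, h3, h2.trans h4.symm⟩, h2⟩
  · rintro ⟨⟨h1, h3, h4⟩, h2⟩
    exact ⟨⟨h1, h2⟩, h3, h4.symm.trans h2⟩

lemma recipEnergy_indicator_le (k : ℕ) (B : Finset (ZMod p)) :
    recipEnergy k (fun x => if x ∈ B then 1 else 0) ≤ (#B : ℝ) ^ (2 * k) := by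
  rw [recipEnergy_indicator]
  have : #{v : (Fin k → ZMod p) × (Fin k → ZMod p) | (∀ i, v.1 i ∈ B) ∧ (∀ i, v.2 i ∈ B) ∧
        ∑ i, (v.1 i)⁻¹ = ∑ i, (v.2 i)⁻¹} ≤
      #(Fintype.piFinset (fun _ : Fin k => B) ×ˢ Fintype.piFinset (fun _ : Fin k => B)) := by
    refine Finset.card_le_card fun v hv => ?_
    simp only [Finset.mem_filter, Finset.mem_univ, true_and] at hv
    simp [Fintype.mem_piFinset, hv.1, hv.2.1]
  rw [Finset.card_product, Fintype.card_piFinset_const, ← pow_add, ← two_mul] at this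
  exact_mod_cast this

/-- Two tuples taking every value equally often differ by a permutation. -/
lemma exists_perm_of_card_fiber_eq {ι α : Type*} [Fintype ι] [DecidableEq ι] [DecidableEq α]
    {w w' : ι → α} (h : ∀ t, #{i | w i = t} = #{i | w' i = t}) :
    ∃ σ : Equiv.Perm ι, w = w' ∘ σ := by
  have e : ∀ t, Nonempty ({i // w i = t} ≃ {i // w' i = t}) := fun t =>
    ⟨Fintype.equivOfCardEq (by rw [Fintype.card_subtype, Fintype.card_subtype, h t])⟩
  refine ⟨Equiv.ofFiberEquiv fun t => (e t).some, ?_⟩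
  ext i
  exact (Equiv.ofFiberEquiv_map _ i).symm

/-- A nontrivial equation between sums of `k` shifted reciprocals has at most `2k` solutions `s`. -/
lemma card_shifts_le {k : ℕ} (hkp : k < p) {w w' : Fin k → ZMod p}
    (hw : ¬ ∃ σ : Equiv.Perm (Fin k), w = w' ∘ σ) :
    #{s : ZMod p | (∀ i, s + w i ≠ 0) ∧ (∀ i, s + w' i ≠ 0) ∧
      ∑ i, (s + w i)⁻¹ = ∑ i, (s + w' i)⁻¹} ≤ 2 * k := by
  classical
  let T := Finset.univ.image w ∪ Finset.univ.image w'
  let c : ZMod p → ZMod p := fun t => (#{i | w i = t} : ZMod p) - (#{i | w' i = t} : ZMod p)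
  let Q : Polynomial (ZMod p) :=
    ∑ t ∈ T, Polynomial.C (c t) * ∏ t' ∈ T.erase t, (Polynomial.X + Polynomial.C t')
  have hTc : #T ≤ 2 * k := by
    refine (Finset.card_union_le _ _).trans ?_
    have h1 : #(Finset.univ.image w) ≤ k := Finset.card_image_le.trans (by simp)
    have h2 : #(Finset.univ.image w') ≤ k := Finset.card_image_le.trans (by simp)
    omega
  have hQ : ∀ s, Q.eval s = ∑ t ∈ T, c t * ∏ t' ∈ T.erase t, (s + t') := fun s => by
    simp [Q, Polynomial.eval_finsetSum, Polynomial.eval_prod]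
  have hdeg : Q.natDegree ≤ 2 * k := by
    refine (Polynomial.natDegree_sum_le_of_forall_le _ _ fun t ht => ?_).trans hTc
    refine (Polynomial.natDegree_C_mul_le _ _).trans ?_
    refine (Polynomial.natDegree_prod_le _ _).trans ?_
    simp only [Polynomial.natDegree_X_add_C]
    simpa using Finset.card_le_card (Finset.erase_subset t T)
  have hQ0 : Q ≠ 0 := by
    intro h0
    apply hw
    apply exists_perm_of_card_fiber_eq
    intro t
    by_contra hne
    have hlt : ∀ f : Fin k → ZMod p, #{i | f i = t} < p := fun f =>
      lt_of_le_of_lt ((Finset.card_le_univ _).trans (by simp)) hkp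
    have hct : c t ≠ 0 := by
      intro h
      apply hne
      have h' := sub_eq_zero.1 h
      rw [ZMod.natCast_eq_natCast_iff'] at h'
      rwa [Nat.mod_eq_of_lt (hlt w), Nat.mod_eq_of_lt (hlt w')] at h'
    have htT : t ∈ T := by
      by_contra htT
      apply hct
      simp only [T, Finset.mem_union, Finset.mem_image, Finset.mem_univ, true_and, not_or,
        not_exists] at htT
      simp [c, htT.1, htT.2]
    have h1 := hQ (-t)
    rw [h0, Polynomial.eval_zero, Finset.sum_eq_single_of_mem t htT] at h1
    · rcases mul_eq_zero.1 h1.symm with h2 | h2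
      · exact hct h2
      · obtain ⟨t', ht', h3⟩ := Finset.prod_eq_zero_iff.1 h2
        exact Finset.ne_of_mem_erase ht' (neg_add_eq_zero.1 h3).symm
    · intro t' _ hne'
      rw [Finset.prod_eq_zero (Finset.mem_erase.2 ⟨hne'.symm, htT⟩) (neg_add_cancel t), mul_zero]
  refine le_trans ?_ ((Polynomial.card_roots' Q).trans hdeg)
  refine le_trans (Finset.card_le_card fun s hs => ?_) (Multiset.toFinset_card_le _)
  simp only [Finset.mem_filter, Finset.mem_univ, true_and] at hs
  obtain ⟨h1, h2, h3⟩ := hs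
  rw [Multiset.mem_toFinset, Polynomial.mem_roots hQ0, Polynomial.IsRoot, hQ]
  have hT0 : ∀ t ∈ T, s + t ≠ 0 := by
    intro t ht
    simp only [T, Finset.mem_union, Finset.mem_image, Finset.mem_univ, true_and] at ht
    rcases ht with ⟨i, rfl⟩ | ⟨i, rfl⟩
    exacts [h1 i, h2 i]
  have hfib : ∀ f : Fin k → ZMod p, (∀ i, f i ∈ T) →
      ∑ i, (s + f i)⁻¹ = ∑ t ∈ T, (#{i | f i = t} : ZMod p) * (s + t)⁻¹ := by
    intro f hf
    rw [← Finset.sum_fiberwise_of_maps_to (fun i _ => hf i)]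
    refine Finset.sum_congr rfl fun t _ => ?_
    rw [Finset.sum_congr rfl fun i hi => by rw [(Finset.mem_filter.1 hi).2], Finset.sum_const,
      nsmul_eq_mul]
  rw [hfib w fun i => by simp [T], hfib w' fun i => by simp [T], ← sub_eq_zero,
    ← Finset.sum_sub_distrib] at h3
  calc ∑ t ∈ T, c t * ∏ t' ∈ T.erase t, (s + t')
      = (∏ t' ∈ T, (s + t')) * ∑ t ∈ T, ((#{i | w i = t} : ZMod p) * (s + t)⁻¹ -
          (#{i | w' i = t} : ZMod p) * (s + t)⁻¹) := by
        rw [Finset.mul_sum]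
        refine Finset.sum_congr rfl fun t ht => ?_
        rw [← Finset.mul_prod_erase T _ ht, ← sub_mul]
        field_simp [hT0 t ht]
        exact mul_comm _ _
    _ = 0 := by rw [h3, mul_zero]

lemma sum_recipEnergy_translates_le {k : ℕ} (hkp : k < p) (S W : Finset (ZMod p)) :
    ∑ s ∈ S, recipEnergy k (fun x => if x ∈ ({x | x ≠ 0 ∧ x - s ∈ W} : Finset (ZMod p))
      then 1 else 0) ≤ (#S : ℝ) * (k.factorial * (#W : ℝ) ^ k) + 2 * k * (#W : ℝ) ^ (2 * k) := by
  classical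
  let P := Fintype.piFinset (fun _ : Fin k => W) ×ˢ Fintype.piFinset (fun _ : Fin k => W)
  let R : ZMod p → (Fin k → ZMod p) × (Fin k → ZMod p) → Prop := fun s v =>
    (∀ i, s + v.1 i ≠ 0) ∧ (∀ i, s + v.2 i ≠ 0) ∧ ∑ i, (s + v.1 i)⁻¹ = ∑ i, (s + v.2 i)⁻¹
  let triv : (Fin k → ZMod p) × (Fin k → ZMod p) → Prop := fun v =>
    ∃ σ : Equiv.Perm (Fin k), v.1 = v.2 ∘ σ
  have hP : #P = #W ^ (2 * k) := by
    rw [Finset.card_product, Fintype.card_piFinset_const, ← pow_add, ← two_mul]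
  have htriv : #(P.filter triv) ≤ k.factorial * #W ^ k := by
    have : P.filter triv ⊆ ((Finset.univ : Finset (Equiv.Perm (Fin k))) ×ˢ
        Fintype.piFinset (fun _ : Fin k => W)).image (fun q => (q.2 ∘ q.1, q.2)) := by
      rintro ⟨v, v'⟩ hv
      obtain ⟨h1, σ, h2⟩ := Finset.mem_filter.1 hv
      simp only at h2
      exact Finset.mem_image.2 ⟨(σ, v'), by simpa using (Finset.mem_product.1 h1).2, by simp [h2]⟩
    refine (Finset.card_le_card this).trans (Finset.card_image_le.trans ?_)
    rw [Finset.card_product, Fintype.card_piFinset_const, Finset.card_univ, Fintype.card_perm,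
      Fintype.card_fin]
  have hle : ∀ s, recipEnergy k (fun x => if x ∈ ({x | x ≠ 0 ∧ x - s ∈ W} : Finset (ZMod p))
      then 1 else 0) ≤ #(P.filter (R s)) := by
    intro s
    rw [recipEnergy_indicator]
    refine Nat.cast_le.2 (Finset.card_le_card_of_injOn
      (fun v => (fun i => v.1 i - s, fun i => v.2 i - s)) ?_ ?_)
    · intro v hv
      simp only [Finset.coe_filter, Finset.mem_filter, Finset.mem_univ, true_and,
        Set.mem_ofPred_eq] at hv
      obtain ⟨h1, h2, h3⟩ := hv
      simp only [Finset.coe_filter, Set.mem_ofPred_eq, P, R, Finset.mem_product,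
        Fintype.mem_piFinset, add_sub_cancel]
      exact ⟨⟨fun i => (h1 i).2, fun i => (h2 i).2⟩, fun i => (h1 i).1, fun i => (h2 i).1, h3⟩
    · rintro ⟨v1, v2⟩ _ ⟨v3, v4⟩ _ h
      simp only [Prod.mk.injEq, funext_iff, sub_left_inj] at h
      exact Prod.ext (funext h.1) (funext h.2)
  have hcount : ∑ s ∈ S, #(P.filter (R s)) ≤
      #S * (k.factorial * #W ^ k) + 2 * k * #W ^ (2 * k) := by
    calc ∑ s ∈ S, #(P.filter (R s)) = ∑ v ∈ P, #(S.filter fun s => R s v) :=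
          Finset.sum_card_bipartiteAbove_eq_sum_card_bipartiteBelow R
      _ = ∑ v ∈ P with triv v, #(S.filter fun s => R s v) +
          ∑ v ∈ P with ¬ triv v, #(S.filter fun s => R s v) :=
          (Finset.sum_filter_add_sum_filter_not _ _ _).symm
      _ ≤ ∑ v ∈ P with triv v, #S + ∑ v ∈ P with ¬ triv v, 2 * k := by
          refine add_le_add (Finset.sum_le_sum fun v _ => Finset.card_filter_le _ _)
            (Finset.sum_le_sum fun v hv => ?_)
          refine le_trans (Finset.card_le_card ?_) (card_shifts_le hkp (Finset.mem_filter.1 hv).2)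
          intro s hs
          simpa [R] using (Finset.mem_filter.1 hs).2
      _ ≤ _ := by
          rw [Finset.sum_const, Finset.sum_const, smul_eq_mul, smul_eq_mul, mul_comm _ #S,
            mul_comm _ (2 * k), ← hP]
          exact add_le_add (Nat.mul_le_mul_left _ htriv)
            (Nat.mul_le_mul_left _ (Finset.card_filter_le _ _))
  refine (Finset.sum_le_sum fun s _ => hle s).trans ?_
  exact_mod_cast hcount

end Counting

section Divisors

lemma add_one_le_mul_rpow {δ : ℝ} (hδ : 0 < δ) {q a : ℕ} (hq : 2 ≤ q) :
    (a : ℝ) + 1 ≤ (1 + 1 / (δ * Real.log 2)) * ((q : ℝ) ^ a) ^ δ := by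
  have hlog : 0 < Real.log 2 := Real.log_pos one_lt_two
  have h2 : (2 : ℝ) ≤ q := by exact_mod_cast hq
  have h1 : 1 + δ * Real.log 2 * a ≤ ((q : ℝ) ^ a) ^ δ := by
    calc 1 + δ * Real.log 2 * a ≤ Real.exp (δ * Real.log 2 * a) := by
          linarith [Real.add_one_le_exp (δ * Real.log 2 * a)]
      _ = ((2 : ℝ) ^ a) ^ δ := by
          rw [← Real.rpow_natCast, ← Real.rpow_mul two_pos.le, Real.rpow_def_of_pos two_pos]
          congr 1; ring
      _ ≤ _ := by gcongr
  have hc : 0 < δ * Real.log 2 := by positivity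
  calc (a : ℝ) + 1 ≤ (1 + 1 / (δ * Real.log 2)) * (1 + δ * Real.log 2 * a) := by
        have : 1 / (δ * Real.log 2) * (δ * Real.log 2 * a) = a := by field_simp
        have h3 : 0 < 1 / (δ * Real.log 2) := by positivity
        have h4 : 0 ≤ δ * Real.log 2 * a := by positivity
        linarith [mul_add (1 + 1 / (δ * Real.log 2)) 1 (δ * Real.log 2 * a),
          add_mul 1 (1 / (δ * Real.log 2)) (δ * Real.log 2 * a)]
    _ ≤ _ := by gcongr

/-- The divisor bound `d(n) ≪ n^δ`. -/
lemma exists_card_divisors_le {δ : ℝ} (hδ : 0 < δ) :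
    ∃ C : ℝ, 1 ≤ C ∧ ∀ n : ℕ, 0 < n → (#n.divisors : ℝ) ≤ C * (n : ℝ) ^ δ := by
  set K : ℝ := 1 + 1 / (δ * Real.log 2) with hK
  have hK1 : 1 ≤ K := by
    have := Real.log_pos one_lt_two
    have : 0 < 1 / (δ * Real.log 2) := by positivity
    linarith
  set B : ℕ := ⌈(2 : ℝ) ^ (1 / δ)⌉₊ with hB
  refine ⟨K ^ B, one_le_pow₀ hK1, fun n hn => ?_⟩
  have hn0 : n ≠ 0 := hn.ne'
  have hfac : (n : ℝ) ^ δ = ∏ q ∈ n.primeFactors, ((q : ℝ) ^ n.factorization q) ^ δ := by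
    rw [Real.finsetProd_rpow _ _ fun q _ => by positivity]
    congr 1
    exact_mod_cast (Nat.prod_factorization_pow_eq_self hn0).symm
  have hsmall : ∏ q ∈ n.primeFactors, (if q < B then K else 1) ≤ K ^ B := by
    rw [Finset.prod_ite, Finset.prod_const, Finset.prod_const_one, mul_one]
    refine pow_le_pow_right₀ hK1 ?_
    refine (Finset.card_le_card (t := Finset.range B) fun q hq => ?_).trans (by simp)
    simpa using (Finset.mem_filter.1 hq).2
  rw [Nat.card_divisors hn0, hfac]
  push_cast
  calc ∏ q ∈ n.primeFactors, ((n.factorization q : ℝ) + 1)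
      ≤ ∏ q ∈ n.primeFactors, ((if q < B then K else 1) *
          ((q : ℝ) ^ n.factorization q) ^ δ) := by
        refine Finset.prod_le_prod (fun _ _ => by positivity) fun q hq => ?_
        have hq2 := (Nat.prime_of_mem_primeFactors hq).two_le
        split_ifs with h
        · exact add_one_le_mul_rpow hδ hq2
        · have h1 : (2 : ℝ) ^ (1 / δ) ≤ q := (Nat.le_ceil _).trans (by exact_mod_cast not_lt.1 h)
          have h2 : (2 : ℝ) ≤ (q : ℝ) ^ δ := by
            calc (2 : ℝ) = ((2 : ℝ) ^ (1 / δ)) ^ δ := by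
                  rw [← Real.rpow_mul two_pos.le, one_div_mul_cancel hδ.ne', Real.rpow_one]
              _ ≤ _ := by gcongr
          rw [one_mul, ← Real.rpow_natCast, ← Real.rpow_mul (by positivity), mul_comm _ δ,
            Real.rpow_mul (by positivity), Real.rpow_natCast]
          calc ((n.factorization q : ℝ) + 1) ≤ 2 ^ n.factorization q := by
                exact_mod_cast Nat.lt_two_pow_self
            _ ≤ _ := by gcongr
    _ = (∏ q ∈ n.primeFactors, (if q < B then K else 1)) *
          ∏ q ∈ n.primeFactors, ((q : ℝ) ^ n.factorization q) ^ δ := Finset.prod_mul_distrib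
    _ ≤ _ := by
        refine mul_le_mul_of_nonneg_right hsmall (Finset.prod_nonneg fun _ _ => by positivity)

end Divisors

section Quotients

variable {p : ℕ} [Fact p.Prime]

lemma card_Ioc_filter_cast_eq_le (a b : ℤ) (hab : a ≤ b) (c : ZMod p) :
    (#{m ∈ Finset.Ioc a b | ((m : ℤ) : ZMod p) = c} : ℝ) ≤ (b - a) / p + 1 := by
  have hp : (0 : ℤ) < p := by exact_mod_cast (Fact.out : p.Prime).pos
  have hp' : (0 : ℝ) < p := by exact_mod_cast hp
  obtain ⟨v, rfl⟩ := ZMod.intCast_surjective c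
  simp_rw [ZMod.intCast_eq_intCast_iff]
  have h := Int.Ioc_filter_modEq_card a b hp v
  have hcard : (#{m ∈ Finset.Ioc a b | m ≡ v [ZMOD p]} : ℝ) =
      ((max (⌊((b - v : ℤ) : ℚ) / ((p : ℤ) : ℚ)⌋ - ⌊((a - v : ℤ) : ℚ) / ((p : ℤ) : ℚ)⌋) 0 :
        ℤ) : ℝ) := by
    rw [← Int.cast_natCast, h]; push_cast; rfl
  rw [hcard]
  rcases max_cases (⌊((b - v : ℤ) : ℚ) / ((p : ℤ) : ℚ)⌋ - ⌊((a - v : ℤ) : ℚ) / ((p : ℤ) : ℚ)⌋) 0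
    with ⟨e, -⟩ | ⟨e, -⟩
  · rw [e]
    have h1 := Int.floor_le (((b - v : ℤ) : ℚ) / ((p : ℤ) : ℚ))
    have h2 := Int.lt_floor_add_one (((a - v : ℤ) : ℚ) / ((p : ℤ) : ℚ))
    have h3 : ((⌊((b - v : ℤ) : ℚ) / ((p : ℤ) : ℚ)⌋ -
        ⌊((a - v : ℤ) : ℚ) / ((p : ℤ) : ℚ)⌋ : ℤ) : ℚ) ≤ ((b : ℚ) - a) / p + 1 := by
      push_cast at h1 h2 ⊢
      have : ((b : ℚ) - a) / p = (b - v) / p - (a - v) / p := by ring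
      linarith
    exact_mod_cast h3
  · rw [e]
    have : (0 : ℝ) ≤ (b - a : ℝ) := by exact_mod_cast sub_nonneg.2 hab
    push_cast; positivity

/-- The number of coincidences among the quotients `(A + y)/u`. -/
lemma card_quotient_coincidences_le (A : ZMod p) {L U D : ℕ} (hU : U < p) (hUL : U ≤ L)
    (hLU : L * U ≤ 2 * p) (hL : L ≤ 2 * p)
    (hD : ∀ n : ℕ, 0 < n → n ≤ L * U → #n.divisors ≤ D) (hD1 : 1 ≤ D) :
    #{v ∈ (Finset.Icc 1 L ×ˢ Finset.Icc 1 U) ×ˢ (Finset.Icc 1 L ×ˢ Finset.Icc 1 U) |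
      (A + (v.1.1 : ZMod p)) * (v.2.2 : ZMod p) = (A + (v.2.1 : ZMod p)) * (v.1.2 : ZMod p)} ≤
      14 * (L * U) * D := by
  classical
  have hp' : (0 : ℝ) < p := by exact_mod_cast (Fact.out : p.Prime).pos
  set Q := {v ∈ (Finset.Icc 1 L ×ˢ Finset.Icc 1 U) ×ˢ (Finset.Icc 1 L ×ˢ Finset.Icc 1 U) |
      (A + (v.1.1 : ZMod p)) * (v.2.2 : ZMod p) = (A + (v.2.1 : ZMod p)) * (v.1.2 : ZMod p)}
    with hQ
  have hmem : ∀ v ∈ Q, ((1 ≤ v.1.1 ∧ v.1.1 ≤ L) ∧ (1 ≤ v.1.2 ∧ v.1.2 ≤ U)) ∧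
      ((1 ≤ v.2.1 ∧ v.2.1 ≤ L) ∧ (1 ≤ v.2.2 ∧ v.2.2 ≤ U)) ∧
      (A + (v.1.1 : ZMod p)) * (v.2.2 : ZMod p) = (A + (v.2.1 : ZMod p)) * (v.1.2 : ZMod p) := by
    intro v hv
    simpa only [hQ, Finset.mem_filter, Finset.mem_product, Finset.mem_Icc, and_assoc] using hv
  have hzero : #{y ∈ Finset.Icc 1 L | A + ((y : ℕ) : ZMod p) = 0} ≤ 3 := by
    have h1 := card_Ioc_filter_cast_eq_le (p := p) 0 L (by positivity) (-A)
    have h2 : #{y ∈ Finset.Icc 1 L | A + ((y : ℕ) : ZMod p) = 0} ≤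
        #{m ∈ Finset.Ioc (0 : ℤ) L | ((m : ℤ) : ZMod p) = -A} := by
      refine Finset.card_le_card_of_injOn (fun y : ℕ => (y : ℤ)) ?_ ?_
      · intro y hy
        simp only [Finset.coe_filter, Set.mem_ofPred_eq, Finset.mem_Icc] at hy
        simp only [Finset.coe_filter, Set.mem_ofPred_eq, Finset.mem_Ioc, Int.cast_natCast]
        exact ⟨by omega, by rw [eq_neg_iff_add_eq_zero, add_comm]; exact hy.2⟩
      · intro y _ y' _ h
        simpa using h
    have h3 : ((L : ℝ) - 0) / p ≤ 2 := by
      rw [div_le_iff₀ hp', sub_zero]; exact_mod_cast hL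
    have h4 : (#{m ∈ Finset.Ioc (0 : ℤ) L | ((m : ℤ) : ZMod p) = -A} : ℝ) ≤ 3 := by
      push_cast at h1; linarith
    have h5 : #{m ∈ Finset.Ioc (0 : ℤ) L | ((m : ℤ) : ZMod p) = -A} ≤ 3 := by exact_mod_cast h4
    exact h2.trans h5
  have hdiag : #{v ∈ Q | v.1.1 = v.2.1} ≤ 4 * (L * U) := by
    have hsub : {v ∈ Q | v.1.1 = v.2.1} ⊆
        ((Finset.Icc 1 L ×ˢ Finset.Icc 1 U).image fun w => (w, w)) ∪
        (({y ∈ Finset.Icc 1 L | A + ((y : ℕ) : ZMod p) = 0} ×ˢ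
          (Finset.Icc 1 U ×ˢ Finset.Icc 1 U)).image fun w => ((w.1, w.2.1), (w.1, w.2.2))) := by
      rintro ⟨⟨y, u⟩, ⟨y', u'⟩⟩ hv
      obtain ⟨hv, hy⟩ := Finset.mem_filter.1 hv
      obtain ⟨⟨hy1, hu⟩, ⟨-, hu'⟩, h⟩ := hmem _ hv
      simp only at hy hy1 hu hu' h
      subst hy
      by_cases h0 : A + (y : ZMod p) = 0
      · refine Finset.mem_union_right _ (Finset.mem_image.2 ⟨(y, u, u'), ?_, rfl⟩)
        simp [h0, hy1, hu, hu']
      · refine Finset.mem_union_left _ (Finset.mem_image.2 ⟨(y, u), ?_, ?_⟩)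
        · simp [hy1, hu]
        · have h1 := mul_left_cancel₀ h0 h
          rw [ZMod.natCast_eq_natCast_iff', Nat.mod_eq_of_lt (by omega),
            Nat.mod_eq_of_lt (by omega)] at h1
          rw [h1]
    refine (Finset.card_le_card hsub).trans ((Finset.card_union_le _ _).trans ?_)
    refine (add_le_add Finset.card_image_le Finset.card_image_le).trans ?_
    simp only [Finset.card_product, Nat.card_Icc, Nat.add_sub_cancel]
    have : #{y ∈ Finset.Icc 1 L | A + ((y : ℕ) : ZMod p) = 0} * (U * U) ≤ 3 * (L * U) :=
      Nat.mul_le_mul hzero (Nat.mul_le_mul_right _ hUL)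
    omega
  have hoff : #{v ∈ Q | ¬ v.1.1 = v.2.1} ≤ D * (10 * (L * U)) := by
    let M : ℤ → Finset ℤ := fun d =>
      {m ∈ Finset.Ioc (-(L * U : ℤ)) (L * U) | ((m : ℤ) : ZMod p) = A * (d : ZMod p)}
    have hM : ∀ d, #(M d) ≤ 5 := by
      intro d
      have h1 := card_Ioc_filter_cast_eq_le (p := p) (-(L * U : ℤ)) (L * U)
        (by have : (0 : ℤ) ≤ L * U := by positivity
            linarith) (A * (d : ZMod p))
      have h2 : ((L : ℝ) * U - -(L * U)) / p ≤ 4 := by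
        rw [div_le_iff₀ hp']
        have : (L : ℝ) * U ≤ 2 * p := by exact_mod_cast hLU
        linarith
      push_cast at h1
      have h3 : (#(M d) : ℝ) ≤ 5 := by simp only [M]; linarith
      exact_mod_cast h3
    let T : Finset ((_ : ℤ × ℕ) × ℤ) :=
      (Finset.Ioc (-U : ℤ) U ×ˢ Finset.Icc 1 L).sigma fun w => M w.1
    have hT : #T ≤ 10 * (L * U) := by
      rw [Finset.card_sigma]
      refine (Finset.sum_le_card_nsmul _ _ 5 fun w _ => hM w.1).trans ?_
      rw [Finset.card_product, Int.card_Ioc, Nat.card_Icc, smul_eq_mul]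
      have : ((U : ℤ) - -U).toNat = 2 * U := by omega
      rw [this, Nat.add_sub_cancel]
      exact le_of_eq (by ring)
    refine (Finset.card_le_mul_card_image_of_maps_to (t := T)
      (f := fun v => ⟨((v.2.2 : ℤ) - v.1.2, v.1.1), (v.2.1 : ℤ) * v.1.2 - v.1.1 * v.2.2⟩)
      ?_ D ?_).trans (Nat.mul_le_mul_left _ hT)
    · rintro ⟨⟨y, u⟩, ⟨y', u'⟩⟩ hv
      obtain ⟨⟨hy, hu⟩, ⟨hy', hu'⟩, h⟩ := hmem _ (Finset.mem_filter.1 hv).1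
      simp only at hy hu hy' hu' h
      simp only [T, M, Finset.mem_sigma, Finset.mem_product, Finset.mem_Ioc, Finset.mem_Icc,
        Finset.mem_filter]
      have b1 : (y' : ℤ) * u ≤ L * U := by exact_mod_cast Nat.mul_le_mul hy'.2 hu.2
      have b2 : (y : ℤ) * u' ≤ L * U := by exact_mod_cast Nat.mul_le_mul hy.2 hu'.2
      have b3 : (1 : ℤ) ≤ y' * u := by exact_mod_cast Nat.mul_le_mul hy'.1 hu.1
      have b4 : (1 : ℤ) ≤ y * u' := by exact_mod_cast Nat.mul_le_mul hy.1 hu'.1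
      refine ⟨⟨⟨by omega, by omega⟩, hy⟩, ⟨by omega, by omega⟩, ?_⟩
      push_cast
      linear_combination -h
    · rintro ⟨⟨d, y⟩, m⟩ _
      by_cases hne : ({v ∈ {v ∈ Q | ¬ v.1.1 = v.2.1} |
          (⟨((v.2.2 : ℤ) - v.1.2, v.1.1), (v.2.1 : ℤ) * v.1.2 - v.1.1 * v.2.2⟩ :
            (_ : ℤ × ℕ) × ℤ) = ⟨(d, y), m⟩}).Nonempty
      swap
      · rw [Finset.not_nonempty_iff_eq_empty.1 hne]; simp
      have hfib : ∀ v ∈ {v ∈ {v ∈ Q | ¬ v.1.1 = v.2.1} |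
          (⟨((v.2.2 : ℤ) - v.1.2, v.1.1), (v.2.1 : ℤ) * v.1.2 - v.1.1 * v.2.2⟩ :
            (_ : ℤ × ℕ) × ℤ) = ⟨(d, y), m⟩},
          v.1.1 = y ∧ (v.2.2 : ℤ) = v.1.2 + d ∧ ((v.2.1 : ℤ) - y) * v.1.2 = m + y * d ∧
            m + y * d ≠ 0 ∧ 1 ≤ v.1.2 ∧ (m + y * d).natAbs ≤ L * U := by
        rintro ⟨⟨y₁, u⟩, ⟨y', u'⟩⟩ hv
        obtain ⟨hv, he⟩ := Finset.mem_filter.1 hv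
        obtain ⟨hv, hyy⟩ := Finset.mem_filter.1 hv
        obtain ⟨⟨hy, hu⟩, ⟨hy', hu'⟩, h⟩ := hmem _ hv
        simp only [Sigma.mk.injEq, Prod.mk.injEq, heq_eq_eq] at he hyy hy hu hy' hu' ⊢
        obtain ⟨⟨he1, he2⟩, he3⟩ := he
        subst he2
        have e : ((y' : ℤ) - y₁) * u = m + y₁ * d := by rw [← he1, ← he3]; ring
        refine ⟨rfl, by linarith, e, ?_, hu.1, ?_⟩
        · rw [← e]
          refine mul_ne_zero (fun h0 => hyy ?_) (by omega)
          omega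
        · rw [← e, Int.natAbs_mul]
          exact Nat.mul_le_mul (by omega) (by simpa using hu.2)
      obtain ⟨v₀, hv₀⟩ := hne
      obtain ⟨-, -, -, hn0, -, hnle⟩ := hfib v₀ hv₀
      refine le_trans ?_ (hD (m + y * d).natAbs (Int.natAbs_pos.2 hn0) hnle)
      refine Finset.card_le_card_of_injOn (fun v => v.1.2) ?_ ?_
      · intro v hv
        obtain ⟨-, -, h3, -, -, -⟩ := hfib v hv
        simp only [Finset.mem_coe, Nat.mem_divisors]
        refine ⟨?_, by simpa using hn0⟩
        rw [← Int.natCast_dvd, ← h3]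
        exact dvd_mul_left _ _
      · intro v hv w hw hvw
        obtain ⟨h1, h2, h3, -, h5, -⟩ := hfib v hv
        obtain ⟨g1, g2, g3, -, -, -⟩ := hfib w hw
        simp only at hvw
        rw [← hvw] at g2 g3
        have h6 : (v.2.1 : ℤ) - y = w.2.1 - y :=
          mul_right_cancel₀ (by omega : (v.1.2 : ℤ) ≠ 0) (h3.trans g3.symm)
        ext
        · exact h1.trans g1.symm
        · exact hvw
        · omega
        · omega
  rw [← Finset.card_filter_add_card_filter_not (s := Q) (fun v => v.1.1 = v.2.1)]
  nlinarith [Nat.le_mul_of_pos_right (4 * (L * U)) hD1]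

end Quotients

section Amplification

variable {p : ℕ} [Fact p.Prime]

lemma sum_card_fiber_sq {ι κ : Type*} [DecidableEq ι] [DecidableEq κ] (P : Finset ι) (g : ι → κ) :
    ∑ s ∈ P.image g, #{w ∈ P | g w = s} ^ 2 = #{v ∈ P ×ˢ P | g v.1 = g v.2} := by
  rw [Finset.card_eq_sum_card_fiberwise (f := fun v => g v.1) (t := P.image g)]
  · refine Finset.sum_congr rfl fun s _ => ?_
    rw [sq, ← Finset.card_product]
    congr 1
    ext v
    simp only [Finset.mem_product, Finset.mem_filter]
    constructor
    · rintro ⟨⟨h1, h2⟩, h3, h4⟩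
      exact ⟨⟨⟨h1, h3⟩, h2.trans h4.symm⟩, h2⟩
    · rintro ⟨⟨⟨h1, h3⟩, h4⟩, h2⟩
      exact ⟨⟨h1, h2⟩, h3, h4.symm.trans h2⟩
  · intro v hv
    have := (Finset.mem_filter.1 (Finset.mem_coe.1 hv)).1
    exact Finset.mem_coe.2 (Finset.mem_image_of_mem g (Finset.mem_product.1 this).1)

/-- The Hölder inequality after grouping the terms of a sum by the value of `g`. -/
lemma sum_rpow_comp_pow_le {ι κ : Type*} [DecidableEq ι] [DecidableEq κ] (P : Finset ι) (g : ι → κ)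
    {J : κ → ℝ} (hJ0 : ∀ s, 0 ≤ J s) {k : ℕ} (hk : 0 < k) :
    (∑ w ∈ P, J (g w) ^ ((1 : ℝ) / (2 * k : ℕ))) ^ (2 * k) ≤
      (#P : ℝ) ^ (2 * k - 2) * (#{v ∈ P ×ˢ P | g v.1 = g v.2} : ℝ) * ∑ s ∈ P.image g, J s := by
  have h2k : ((2 * k : ℕ) : ℝ) ≠ 0 := by positivity
  have hM1 : ∑ s ∈ P.image g, (#{w ∈ P | g w = s} : ℝ) = #P := by
    exact_mod_cast (Finset.card_eq_sum_card_image g P).symm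
  have hM2 : ∑ s ∈ P.image g, (#{w ∈ P | g w = s} : ℝ) ^ 2 =
      #{v ∈ P ×ˢ P | g v.1 = g v.2} := by
    exact_mod_cast sum_card_fiber_sq P g
  have h := sum_mul_pow_le (P.image g) (fun s => (#{w ∈ P | g w = s} : ℝ))
    (fun s => J s ^ ((1 : ℝ) / (2 * k : ℕ))) (fun _ => by positivity)
    (fun s => Real.rpow_nonneg (hJ0 s) _) hk
  rw [hM1, hM2] at h
  rw [Finset.sum_comp (fun s => J s ^ ((1 : ℝ) / (2 * k : ℕ))) g]
  simp_rw [nsmul_eq_mul]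
  refine h.trans (le_of_eq ?_)
  congr 1
  refine Finset.sum_congr rfl fun s _ => ?_
  rw [← Real.rpow_natCast, ← Real.rpow_mul (hJ0 s), one_div_mul_cancel h2k, Real.rpow_one]

lemma natCast_ne_zero_of_lt {u : ℕ} (h1 : 1 ≤ u) (h2 : u < p) : (u : ZMod p) ≠ 0 := by
  rw [Ne, ZMod.natCast_eq_zero_iff]
  exact Nat.not_dvd_of_pos_of_lt h1 h2

lemma card_interval_shifts {a : ZMod p} {N U V : ℕ} (h0 : (0 : ZMod p) ∉ interval p a N)
    (hUV : U * V ≤ N) (hUp : U < p) {x : ZMod p} (hx : x ∈ interval p a N) :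
    U * V ≤ #{w ∈ Finset.Icc 1 (2 * N) ×ˢ Finset.Icc 1 U | (w.2 : ZMod p)⁻¹ * x ≠ 0 ∧
      (w.2 : ZMod p)⁻¹ * x - (w.2 : ZMod p)⁻¹ * (a - ((U * V : ℕ) : ZMod p) + (w.1 : ZMod p)) ∈
        (Finset.range V).image (fun v : ℕ => (v : ZMod p))} := by
  have hx0 : x ≠ 0 := fun h => h0 (h ▸ hx)
  obtain ⟨i, hi, rfl⟩ := Finset.mem_image.1 hx
  rw [Finset.mem_Icc] at hi
  have hc : #(Finset.Icc 1 U ×ˢ Finset.range V) = U * V := by simp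
  have hle : ∀ u v : ℕ, u ≤ U → v < V → u * v ≤ U * V := fun u v hu hv =>
    Nat.mul_le_mul hu hv.le
  refine hc.ge.trans
    (Finset.card_le_card_of_injOn (fun w => (i + (U * V - w.1 * w.2), w.1)) ?_ ?_)
  · rintro ⟨u, v⟩ hw
    simp only [Finset.coe_product, Set.mem_prod, Finset.mem_coe, Finset.mem_Icc,
      Finset.mem_range] at hw
    obtain ⟨hu, hv⟩ := hw
    have hwP : (i + (U * V - u * v), u) ∈ Finset.Icc 1 (2 * N) ×ˢ Finset.Icc 1 U := by
      simp only [Finset.mem_product, Finset.mem_Icc]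
      omega
    have hu' : (u : ZMod p) ≠ 0 := natCast_ne_zero_of_lt hu.1 (by omega)
    simp only [Finset.mem_coe, Finset.mem_filter]
    refine ⟨hwP, mul_ne_zero (inv_ne_zero hu') hx0, Finset.mem_image.2 ⟨v, by simpa using hv, ?_⟩⟩
    rw [← mul_sub, Nat.cast_add, Nat.cast_sub (hle u v hu.2 hv), eq_inv_mul_iff_mul_eq₀ hu',
      Nat.cast_mul u v]
    ring
  · rintro ⟨u, v⟩ hw ⟨u', v'⟩ hw' h
    simp only [Finset.coe_product, Set.mem_prod, Finset.mem_coe, Finset.mem_Icc,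
      Finset.mem_range] at hw hw'
    simp only [Prod.mk.injEq] at h ⊢
    obtain ⟨h1, rfl⟩ := h
    have e1 := hle u v hw.1.2 hw.2
    have e2 := hle u v' hw.1.2 hw'.2
    exact ⟨rfl, Nat.eq_of_mul_eq_mul_left (by omega : 0 < u) (by omega)⟩

/-- Averaging the interval over the shifts `u v` with `1 ≤ u ≤ U` and `0 ≤ v < V`. -/
lemma recipEnergy_interval_amplify {k : ℕ} (hk : 0 < k) (hkp : k < p) (a : ZMod p)
    {N U V D : ℕ} (h0 : (0 : ZMod p) ∉ interval p a N) (hUV : U * V ≤ N) (hUp : U < p)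
    (hV : 1 ≤ V) (hN : N ≤ p) (hNU : N * U ≤ p)
    (hD : ∀ n : ℕ, 0 < n → n ≤ (2 * N) * U → #n.divisors ≤ D) (hD1 : 1 ≤ D) :
    ((U * V : ℕ) : ℝ) ^ (2 * k) * recipEnergy k (fun x => if x ∈ interval p a N then 1 else 0) ≤
      (((2 * N) * U : ℕ) : ℝ) ^ (2 * k - 2) * ((14 * ((2 * N) * U) * D : ℕ) : ℝ) *
        ((((2 * N) * U : ℕ) : ℝ) * (k.factorial * (V : ℝ) ^ k) + 2 * k * (V : ℝ) ^ (2 * k)) := by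
  classical
  set L := 2 * N with hL
  set A : ZMod p := a - ((U * V : ℕ) : ZMod p) with hA
  set P := Finset.Icc 1 L ×ˢ Finset.Icc 1 U with hP
  set W : Finset (ZMod p) := (Finset.range V).image (fun v : ℕ => (v : ZMod p)) with hW
  have hWV : #W ≤ V := Finset.card_image_le.trans (by simp)
  let B : ZMod p → Finset (ZMod p) := fun s => {x | x ≠ 0 ∧ x - s ∈ W}
  let g : ℕ × ℕ → ZMod p := fun w => (w.2 : ZMod p)⁻¹ * (A + (w.1 : ZMod p))
  let J : ZMod p → ℝ := fun s => recipEnergy k (fun x => if x ∈ B s then 1 else 0)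
  have hu0 : ∀ w ∈ P, (w.2 : ZMod p) ≠ 0 := by
    intro w hw
    have := Finset.mem_Icc.1 (Finset.mem_product.1 hw).2
    exact natCast_ne_zero_of_lt this.1 (by omega)
  have hcover : ∀ x ∈ interval p a N,
      U * V ≤ #{w ∈ P | (w.2 : ZMod p)⁻¹ * x ∈ B (g w)} := fun x hx => by
    simpa only [← hP, B, g, Finset.mem_filter, Finset.mem_univ, true_and] using
      card_interval_shifts h0 hUV hUp hx
  let F : ℕ × ℕ → ZMod p → ℂ := fun w x => if (w.2 : ZMod p)⁻¹ * x ∈ B (g w) then 1 else 0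
  have hFJ : ∀ w ∈ P, recipEnergy k (F w) = J (g w) := fun w hw =>
    recipEnergy_dilate k (fun x => if x ∈ B (g w) then (1 : ℂ) else 0) (inv_ne_zero (hu0 w hw))
  have step1 : ((U * V : ℕ) : ℝ) ^ (2 * k) *
      recipEnergy k (fun x => if x ∈ interval p a N then 1 else 0) ≤
      (∑ w ∈ P, J (g w) ^ ((1 : ℝ) / (2 * k : ℕ))) ^ (2 * k) := by
    have h1 := recipEnergy_const_mul (p := p) k ((U * V : ℕ) : ℂ)
      (fun x => if x ∈ interval p a N then 1 else 0)
    rw [Complex.norm_natCast] at h1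
    rw [← h1]
    refine (recipEnergy_mono (g := fun x => ∑ w ∈ P,
      if (w.2 : ZMod p)⁻¹ * x ∈ B (g w) then (1 : ℝ) else 0) (fun x => ?_) k).trans ?_
    · rw [Finset.sum_boole]
      split_ifs with hx
      · rw [mul_one, Complex.norm_natCast]
        exact_mod_cast hcover x hx
      · simp
    · have hF : (fun x => ((∑ w ∈ P,
          if (w.2 : ZMod p)⁻¹ * x ∈ B (g w) then (1 : ℝ) else 0 : ℝ) : ℂ)) =
          fun x => ∑ w ∈ P, F w x := by
        funext x
        rw [Complex.ofReal_sum]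
        refine Finset.sum_congr rfl fun w _ => ?_
        simp only [F, apply_ite Complex.ofReal, Complex.ofReal_one, Complex.ofReal_zero]
      rw [hF]
      refine (recipEnergy_sum_le hk P F).trans (le_of_eq ?_)
      rw [Finset.sum_congr rfl fun w hw => by rw [hFJ w hw]]
  have hPc : #P = L * U := by simp [hP]
  have hS : #(P.image g) ≤ L * U := hPc ▸ Finset.card_image_le
  have hJ0 : ∀ s, 0 ≤ J s := fun s => recipEnergy_nonneg _ _
  have hM2 : #{v ∈ P ×ˢ P | g v.1 = g v.2} ≤ 14 * (L * U) * D := by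
    have hUN : U ≤ N := (Nat.le_mul_of_pos_right U hV).trans hUV
    have h2 := card_quotient_coincidences_le A hUp (by omega : U ≤ L)
      (by rw [hL, mul_assoc]; omega) (by omega) hD hD1
    refine (Finset.card_le_card fun v hv => ?_).trans h2
    obtain ⟨hv, he⟩ := Finset.mem_filter.1 hv
    refine Finset.mem_filter.2 ⟨hv, ?_⟩
    obtain ⟨hv1, hv2⟩ := Finset.mem_product.1 hv
    have n1 := hu0 _ hv1
    have n2 := hu0 _ hv2
    simp only [g] at he
    field_simp at he
    linear_combination he
  have hM2' : (#{v ∈ P ×ˢ P | g v.1 = g v.2} : ℝ) ≤ ((14 * (L * U) * D : ℕ) : ℝ) :=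
    Nat.cast_le.2 hM2
  have c1 : (#(P.image g) : ℝ) ≤ (L * U : ℕ) := Nat.cast_le.2 hS
  have c2 : (#W : ℝ) ≤ V := Nat.cast_le.2 hWV
  have hmono : ∀ x y : ℝ, 0 ≤ y → x ≤ (L * U : ℕ) → y ≤ V →
      x * (k.factorial * y ^ k) + 2 * k * y ^ (2 * k) ≤
        ((L * U : ℕ) : ℝ) * (k.factorial * (V : ℝ) ^ k) + 2 * k * (V : ℝ) ^ (2 * k) := by
    intro x y hy h1 h2
    gcongr
  have hfin : ∑ s ∈ P.image g, J s ≤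
      ((L * U : ℕ) : ℝ) * (k.factorial * (V : ℝ) ^ k) + 2 * k * (V : ℝ) ^ (2 * k) :=
    (sum_recipEnergy_translates_le hkp (P.image g) W).trans (hmono _ _ (Nat.cast_nonneg _) c1 c2)
  refine step1.trans ((sum_rpow_comp_pow_le P g hJ0 hk).trans ?_)
  rw [hPc]
  exact mul_le_mul (mul_le_mul_of_nonneg_left hM2' (by positivity)) hfin
    (Finset.sum_nonneg fun s _ => hJ0 s) (by positivity)

end Amplification

section EnergyBound

variable {p : ℕ} [Fact p.Prime]

lemma length_lt_of_zero_notMem_interval {a : ZMod p} {N : ℕ} (h : (0 : ZMod p) ∉ interval p a N) :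
    N < p := by
  by_contra! hN
  have hp := (Fact.out : p.Prime).pos
  have hlt := ZMod.val_lt (-a)
  apply h
  rcases Nat.eq_zero_or_pos (-a).val with h0 | h0
  · rw [ZMod.val_eq_zero, neg_eq_zero] at h0
    exact Finset.mem_image.2 ⟨p, Finset.mem_Icc.2 ⟨hp, hN⟩, by simp [h0]⟩
  · exact Finset.mem_image.2 ⟨(-a).val, Finset.mem_Icc.2 ⟨h0, by omega⟩, by simp⟩

lemma card_interval {a : ZMod p} {N : ℕ} (h : (0 : ZMod p) ∉ interval p a N) :
    #(interval p a N) = N := by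
  have hN := length_lt_of_zero_notMem_interval h
  rw [interval, Finset.card_image_of_injOn, Nat.card_Icc, Nat.add_sub_cancel]
  intro i hi j hj hij
  simp only [Finset.coe_Icc, Set.mem_Icc] at hi hj
  have h1 := add_left_cancel hij
  rwa [ZMod.natCast_eq_natCast_iff', Nat.mod_eq_of_lt (by omega), Nat.mod_eq_of_lt (by omega)] at h1

/-- The amplified bound, when the shift parameters satisfy `N² ≤ V^(k+1)`. -/
lemma recipEnergy_interval_le_of_shift {k : ℕ} (hk : 0 < k) (hkp : k < p) (a : ZMod p)
    {N V D : ℕ} (h0 : (0 : ZMod p) ∉ interval p a N) (hV : 1 ≤ V) (hVN : V ≤ N)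
    (hNV : N ^ 2 ≤ V ^ (k + 1)) (hNU : N * (N / V) ≤ p)
    (hD : ∀ n : ℕ, 0 < n → n ≤ 2 * N ^ 2 → #n.divisors ≤ D) (hD1 : 1 ≤ D) :
    recipEnergy k (fun x => if x ∈ interval p a N then 1 else 0) ≤
      (28 * 4 ^ k * (k.factorial + k) : ℕ) * D * ((N : ℝ) ^ (2 * k - 2) * V) := by
  have hN : N < p := length_lt_of_zero_notMem_interval h0
  set U := N / V with hUdef
  have hU1 : 1 ≤ U := Nat.div_pos hVN hV
  have hUN : U ≤ N := Nat.div_le_self _ _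
  have hUV : U * V ≤ N := Nat.div_mul_le_self N V
  have hUV2 : N ≤ 2 * (U * V) := by
    have h1 : N < V * (N / V) + V := Nat.lt_mul_div_succ N hV
    have h2 : V ≤ U * V := Nat.le_mul_of_pos_left V hU1
    rw [← hUdef, mul_comm] at h1
    omega
  have h := recipEnergy_interval_amplify hk hkp a h0 hUV (by omega) hV hN.le hNU
    (fun n hn hn' => hD n hn (hn'.trans (by
      rw [mul_assoc, sq]; exact Nat.mul_le_mul_left 2 (Nat.mul_le_mul_left N hUN)))) hD1
  set E := recipEnergy k (fun x => if x ∈ interval p a N then 1 else 0) with hE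
  have hE0 : 0 ≤ E := recipEnergy_nonneg _ _
  have hbr : (((2 * N) * U : ℕ) : ℝ) * (k.factorial * (V : ℝ) ^ k) + 2 * k * (V : ℝ) ^ (2 * k) ≤
      2 * (k.factorial + k) * (V : ℝ) ^ (2 * k) := by
    have h1 : N * U * V ^ k ≤ V ^ (2 * k) := by
      obtain ⟨j, rfl⟩ : ∃ j, k = j + 1 := ⟨k - 1, by omega⟩
      calc N * U * V ^ (j + 1) = N * (U * V) * V ^ j := by ring
        _ ≤ N * N * V ^ j := by gcongr
        _ = N ^ 2 * V ^ j := by ring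
        _ ≤ V ^ (j + 1 + 1) * V ^ j := by gcongr
        _ = V ^ (2 * (j + 1)) := by ring
    have h2 : (N : ℝ) * U * (V : ℝ) ^ k ≤ (V : ℝ) ^ (2 * k) := by exact_mod_cast h1
    push_cast
    have h3 := mul_le_mul_of_nonneg_left h2 (by positivity : (0 : ℝ) ≤ 2 * k.factorial)
    linarith
  have hVpos : (0 : ℝ) < V := by exact_mod_cast hV
  have hUpos : (0 : ℝ) < U := by exact_mod_cast hU1
  have hNpos : (0 : ℝ) < N := by exact_mod_cast hV.trans hVN
  have h' : ((U : ℝ) * V) ^ (2 * k) * E ≤ (2 * N * U) ^ (2 * k - 2) * (14 * (2 * N * U) * D) *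
      (2 * (k.factorial + k) * (V : ℝ) ^ (2 * k)) := by
    have := h.trans (mul_le_mul_of_nonneg_left hbr (by positivity))
    push_cast at this
    exact this
  obtain ⟨j, rfl⟩ : ∃ j, k = j + 1 := ⟨k - 1, by omega⟩
  have e1 : 2 * (j + 1) - 2 = 2 * j := by omega
  rw [e1] at h' ⊢
  set c : ℝ := ((j + 1).factorial : ℝ) + ((j + 1 : ℕ) : ℝ) with hc
  have h'' : U * E ≤ 56 * 4 ^ j * c * D * ((N : ℝ) ^ (2 * j) * N) := by
    have hpos : (0 : ℝ) < (U : ℝ) ^ (2 * j + 1) * (V : ℝ) ^ (2 * (j + 1)) := by positivity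
    refine le_of_mul_le_mul_left ?_ hpos
    have e4 : (4 : ℝ) ^ j = 2 ^ (2 * j) := by rw [pow_mul]; norm_num
    calc (U : ℝ) ^ (2 * j + 1) * (V : ℝ) ^ (2 * (j + 1)) * (U * E)
        = ((U : ℝ) * V) ^ (2 * (j + 1)) * E := by rw [mul_pow]; ring
      _ ≤ _ := h'
      _ = _ := by rw [mul_pow, mul_pow, e4]; ring
  have h3 : N * E ≤ N * (28 * 4 ^ (j + 1) * c * D * ((N : ℝ) ^ (2 * j) * V)) := by
    have hUV2' : (N : ℝ) ≤ 2 * (U * V) := by exact_mod_cast hUV2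
    calc N * E ≤ 2 * (U * V) * E := mul_le_mul_of_nonneg_right hUV2' hE0
      _ = 2 * V * (U * E) := by ring
      _ ≤ 2 * V * (56 * 4 ^ j * c * D * ((N : ℝ) ^ (2 * j) * N)) :=
          mul_le_mul_of_nonneg_left h'' (by positivity)
      _ = _ := by ring
  have h4 := le_of_mul_le_mul_left h3 hNpos
  push_cast at h4 ⊢
  simp only [hc] at h4
  push_cast at h4
  exact h4

/-- The energy of reciprocals from an interval in arbitrary position. -/
lemma exists_recipEnergy_interval_le {k : ℕ} (hk : 0 < k) {δ : ℝ} (hδ : 0 < δ) :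
    ∃ C : ℝ, 0 < C ∧ ∀ (p : ℕ) [Fact p.Prime] (a : ZMod p) (N : ℕ), 1 ≤ N →
      (0 : ZMod p) ∉ interval p a N → (N : ℝ) < (p : ℝ) ^ (((k : ℝ) + 1) / (2 * (k : ℝ))) →
      recipEnergy k (fun x => if x ∈ interval p a N then 1 else 0) ≤
        C * (N : ℝ) ^ (2 * (k : ℝ) ^ 2 / (k + 1) + δ) := by
  obtain ⟨C₀, hC₀, hdiv⟩ := exists_card_divisors_le (half_pos hδ)
  set C₁ : ℝ := (28 * 4 ^ k * (k.factorial + k) : ℕ) * (C₀ * 2 ^ (δ / 2)) * 2 with hC₁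
  have hk0 : (0 : ℝ) < k := by exact_mod_cast hk
  have hC₁0 : 0 ≤ C₁ := by positivity
  refine ⟨(k : ℝ) ^ (2 * k) + C₁, by positivity, ?_⟩
  intro p hp a N hN1 h0 hNp
  have hN := length_lt_of_zero_notMem_interval h0
  have hNr : (1 : ℝ) ≤ N := by exact_mod_cast hN1
  have hNpos : (0 : ℝ) < N := by linarith
  have hpow1 : (1 : ℝ) ≤ (N : ℝ) ^ (2 * (k : ℝ) ^ 2 / (k + 1) + δ) :=
    Real.one_le_rpow hNr (by positivity)
  rcases le_or_gt p k with hpk | hkp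
  · refine (recipEnergy_indicator_le k _).trans ?_
    rw [card_interval h0]
    calc (N : ℝ) ^ (2 * k) ≤ (k : ℝ) ^ (2 * k) := by
          gcongr; omega
      _ ≤ ((k : ℝ) ^ (2 * k) + C₁) * 1 := by linarith
      _ ≤ _ := by gcongr
  · set v : ℝ := (N : ℝ) ^ ((2 : ℝ) / (k + 1)) with hv
    have hv1 : 1 ≤ v := Real.one_le_rpow hNr (by positivity)
    set V := ⌈v⌉₊ with hVdef
    have hvV : v ≤ V := Nat.le_ceil v
    have hV1 : 1 ≤ V := Nat.one_le_ceil_iff.2 (by linarith)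
    have hk1 : (1 : ℝ) ≤ k := by exact_mod_cast hk
    have hVN : V ≤ N := by
      refine Nat.ceil_le.2 ?_
      calc v ≤ (N : ℝ) ^ (1 : ℝ) := Real.rpow_le_rpow_of_exponent_le hNr (by
            rw [div_le_one (by positivity)]; linarith)
        _ = N := Real.rpow_one _
    have hV2 : (V : ℝ) ≤ 2 * v := by
      have := Nat.ceil_lt_add_one (by linarith : 0 ≤ v)
      linarith
    have hNV : N ^ 2 ≤ V ^ (k + 1) := by
      have : (N : ℝ) ^ 2 ≤ (V : ℝ) ^ (k + 1) := by
        calc (N : ℝ) ^ 2 = v ^ (k + 1) := by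
              rw [hv, ← Real.rpow_natCast, ← Real.rpow_natCast, ← Real.rpow_mul hNpos.le]
              congr 1
              push_cast
              field_simp
          _ ≤ _ := by gcongr
      exact_mod_cast this
    have hNU : N * (N / V) ≤ p := by
      have hdv : ((N / V : ℕ) : ℝ) ≤ N / v :=
        Nat.cast_div_le.trans (div_le_div_of_nonneg_left hNpos.le (by linarith) hvV)
      have : (N : ℝ) * ((N / V : ℕ) : ℝ) ≤ p := by
        calc (N : ℝ) * ((N / V : ℕ) : ℝ) ≤ N * (N / v) := by gcongr
          _ = (N : ℝ) ^ (2 * (k : ℝ) / (k + 1)) := by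
              have e : 2 * (k : ℝ) / (k + 1) = 2 - 2 / (k + 1) := by field_simp; ring
              rw [e, Real.rpow_sub hNpos, ← hv, Real.rpow_two]
              ring
          _ ≤ ((p : ℝ) ^ (((k : ℝ) + 1) / (2 * (k : ℝ)))) ^ (2 * (k : ℝ) / (k + 1)) := by
              gcongr
          _ = p := by
              rw [← Real.rpow_mul (Nat.cast_nonneg p)]
              have e : ((k : ℝ) + 1) / (2 * (k : ℝ)) * (2 * (k : ℝ) / (k + 1)) = 1 := by field_simp
              rw [e, Real.rpow_one]
      exact_mod_cast this
    set d : ℝ := C₀ * (2 * (N : ℝ) ^ 2) ^ (δ / 2) with hd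
    have hd1 : 1 ≤ d := one_le_mul_of_one_le_of_one_le hC₀
      (Real.one_le_rpow (by nlinarith) (half_pos hδ).le)
    have hdeq : d = C₀ * 2 ^ (δ / 2) * (N : ℝ) ^ δ := by
      rw [hd, Real.mul_rpow two_pos.le (by positivity), ← Real.rpow_natCast,
        ← Real.rpow_mul hNpos.le, mul_assoc]
      congr 3
      push_cast
      ring
    have h := recipEnergy_interval_le_of_shift hk hkp a h0 hV1 hVN hNV hNU (D := ⌊d⌋₊)
      (fun n hn hn' => Nat.le_floor ((hdiv n hn).trans (by
        rw [hd]
        have : (n : ℝ) ≤ 2 * (N : ℝ) ^ 2 := by exact_mod_cast hn'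
        gcongr))) (Nat.le_floor (by simpa using hd1))
    have hfl : (⌊d⌋₊ : ℝ) ≤ d := Nat.floor_le (by linarith)
    calc _ ≤ _ := h
      _ ≤ (28 * 4 ^ k * (k.factorial + k) : ℕ) * d * ((N : ℝ) ^ (2 * k - 2) * (2 * v)) := by gcongr
      _ = C₁ * ((N : ℝ) ^ (2 * k - 2) * v * (N : ℝ) ^ δ) := by rw [hdeq, hC₁]; ring
      _ = C₁ * (N : ℝ) ^ (2 * (k : ℝ) ^ 2 / (k + 1) + δ) := by
          rw [hv, ← Real.rpow_natCast, ← Real.rpow_add hNpos, ← Real.rpow_add hNpos]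
          congr 3
          rw [Nat.cast_sub (by omega)]
          push_cast
          field_simp
          ring
      _ ≤ _ := by
          have : (0 : ℝ) ≤ (k : ℝ) ^ (2 * k) := by positivity
          gcongr
          linarith

end EnergyBound

section Bilinear

variable {p : ℕ} [Fact p.Prime]

lemma sum_norm_recipRep_le (k : ℕ) (f : ZMod p → ℂ) :
    ∑ z, ‖recipRep k f z‖ ≤ (∑ x, ‖f x‖) ^ k := by
  calc ∑ z, ‖recipRep k f z‖
      ≤ ∑ z, ∑ x : Fin k → ZMod p with ∑ i, (x i)⁻¹ = z, ∏ i, ‖f (x i)‖ := by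
        refine Finset.sum_le_sum fun z _ => (norm_sum_le _ _).trans (le_of_eq ?_)
        exact Finset.sum_congr rfl fun x _ => norm_prod _ _
    _ = (∑ x, ‖f x‖) ^ k := by
        rw [Finset.sum_fiberwise, Finset.sum_pow']
        simp

lemma norm_bilinear_pow_le {k1 k2 : ℕ} (hk1 : 0 < k1) (hk2 : 0 < k2) (B1 B2 : Finset (ZMod p))
    (α1 α2 : ZMod p → ℂ) (h1 : ∀ x ∈ B1, ‖α1 x‖ ≤ 1) (h2 : ∀ x ∈ B2, ‖α2 x‖ ≤ 1)
    {b : ZMod p} (hb : b ≠ 0) :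
    ‖∑ x1 ∈ B1, ∑ x2 ∈ B2, α1 x1 * α2 x2 * ZMod.stdAddChar (b * x1⁻¹ * x2⁻¹)‖ ^ (2 * k1 * k2) ≤
      ((#B1 : ℝ) ^ (k2 - 1)) ^ (2 * k1) * (((#B2 : ℝ) ^ k2) ^ (2 * k1 - 2) *
        recipEnergy k2 (fun x => if x ∈ B2 then 1 else 0) *
        (p * recipEnergy k1 (fun x => if x ∈ B1 then 1 else 0))) := by
  classical
  let f2 : ZMod p → ℂ := fun x => if x ∈ B2 then α2 x else 0
  have hf2 : ∀ x, ‖f2 x‖ ≤ if x ∈ B2 then (1 : ℝ) else 0 := by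
    intro x
    by_cases hx : x ∈ B2 <;> simp [f2, hx, h2]
  have hcast : ∀ B : Finset (ZMod p), (fun x => ((if x ∈ B then (1 : ℝ) else 0 : ℝ) : ℂ)) =
      fun x => if x ∈ B then (1 : ℂ) else 0 := by
    intro B; funext x; split_ifs <;> simp
  choose θ hθ1 hθ2 using fun x : ZMod p =>
    RCLike.exists_norm_eq_mul_self (recipSum f2 (b * x⁻¹) ^ k2)
  let g : ZMod p → ℂ := fun x => if x ∈ B1 then θ x else 0
  have hg : ∀ x, ‖g x‖ ≤ if x ∈ B1 then (1 : ℝ) else 0 := by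
    intro x
    by_cases hx : x ∈ B1 <;> simp [g, hx, hθ1]
  have s1 : ‖∑ x1 ∈ B1, ∑ x2 ∈ B2, α1 x1 * α2 x2 * ZMod.stdAddChar (b * x1⁻¹ * x2⁻¹)‖ ≤
      ∑ x ∈ B1, ‖recipSum f2 (b * x⁻¹)‖ := by
    refine (norm_sum_le _ _).trans (Finset.sum_le_sum fun x hx => ?_)
    have : ∑ x2 ∈ B2, α1 x * α2 x2 * ZMod.stdAddChar (b * x⁻¹ * x2⁻¹) =
        α1 x * recipSum f2 (b * x⁻¹) := by
      simp [recipSum, f2, ite_mul, Finset.sum_ite_mem, Finset.mul_sum, mul_assoc]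
    rw [this, norm_mul]
    exact mul_le_of_le_one_left (norm_nonneg _) (h1 x hx)
  have s2 : (∑ x ∈ B1, ‖recipSum f2 (b * x⁻¹)‖) ^ k2 ≤
      (#B1 : ℝ) ^ (k2 - 1) * ∑ x ∈ B1, ‖recipSum f2 (b * x⁻¹)‖ ^ k2 := by
    obtain ⟨j, rfl⟩ : ∃ j, k2 = j + 1 := ⟨k2 - 1, by omega⟩
    exact pow_sum_le_card_mul_sum_pow (fun _ _ => norm_nonneg _) j
  have s3 : ∑ x ∈ B1, ‖recipSum f2 (b * x⁻¹)‖ ^ k2 ≤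
      ∑ z, ‖recipRep k2 f2 z‖ * ‖recipSum g (b * z)‖ := by
    have e : ((∑ x ∈ B1, ‖recipSum f2 (b * x⁻¹)‖ ^ k2 : ℝ) : ℂ) =
        ∑ z, recipRep k2 f2 z * recipSum g (b * z) := by
      push_cast
      calc ∑ x ∈ B1, (‖recipSum f2 (b * x⁻¹)‖ : ℂ) ^ k2
          = ∑ x, g x * recipSum f2 (b * x⁻¹) ^ k2 := by
            simp only [g, ite_mul, zero_mul, Finset.sum_ite_mem, Finset.univ_inter]
            refine Finset.sum_congr rfl fun x _ => ?_
            rw [← hθ2, norm_pow]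
            push_cast
            rfl
        _ = ∑ x, ∑ z, recipRep k2 f2 z * (g x * ZMod.stdAddChar (b * z * x⁻¹)) := by
            refine Finset.sum_congr rfl fun x _ => ?_
            rw [recipSum_pow, Finset.mul_sum]
            refine Finset.sum_congr rfl fun z _ => ?_
            rw [mul_right_comm b z]
            ring
        _ = _ := by
            rw [Finset.sum_comm]
            simp_rw [recipSum, Finset.mul_sum]
    have h := congrArg norm e
    rw [Complex.norm_real, Real.norm_of_nonneg (Finset.sum_nonneg fun _ _ => by positivity)] at h
    rw [h]
    refine (norm_sum_le _ _).trans (le_of_eq (Finset.sum_congr rfl fun z _ => norm_mul _ _))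
  have s4 := sum_mul_pow_le Finset.univ (fun z => ‖recipRep k2 f2 z‖)
    (fun z => ‖recipSum g (b * z)‖) (fun _ => norm_nonneg _) (fun _ => norm_nonneg _) hk1
  have s5 : ∑ z, ‖recipRep k2 f2 z‖ ≤ (#B2 : ℝ) ^ k2 := by
    refine (sum_norm_recipRep_le k2 f2).trans (pow_le_pow_left₀ (by positivity) ?_ _)
    refine (Finset.sum_le_sum fun x _ => hf2 x).trans ?_
    simp
  have s6 : ∑ z, ‖recipRep k2 f2 z‖ ^ 2 ≤ recipEnergy k2 (fun x => if x ∈ B2 then 1 else 0) := by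
    have := recipEnergy_mono hf2 k2
    rwa [hcast] at this
  have s7 : ∑ z, ‖recipSum g (b * z)‖ ^ (2 * k1) ≤
      p * recipEnergy k1 (fun x => if x ∈ B1 then 1 else 0) := by
    have e : ∑ z, ‖recipSum g (b * z)‖ ^ (2 * k1) = ∑ μ, ‖recipSum g μ‖ ^ (2 * k1) :=
      Fintype.sum_equiv (Equiv.mulLeft₀ b hb) _ _ fun _ => rfl
    rw [e, sum_norm_recipSum_pow]
    have := recipEnergy_mono hg k1
    rw [hcast] at this
    gcongr
  calc _ ≤ (∑ x ∈ B1, ‖recipSum f2 (b * x⁻¹)‖) ^ (2 * k1 * k2) :=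
        pow_le_pow_left₀ (norm_nonneg _) s1 _
    _ = ((∑ x ∈ B1, ‖recipSum f2 (b * x⁻¹)‖) ^ k2) ^ (2 * k1) := by
        rw [← pow_mul, mul_comm]
    _ ≤ ((#B1 : ℝ) ^ (k2 - 1) * ∑ z, ‖recipRep k2 f2 z‖ * ‖recipSum g (b * z)‖) ^ (2 * k1) :=
        pow_le_pow_left₀ (by positivity) (s2.trans (mul_le_mul_of_nonneg_left s3 (by positivity))) _
    _ = ((#B1 : ℝ) ^ (k2 - 1)) ^ (2 * k1) *
          (∑ z, ‖recipRep k2 f2 z‖ * ‖recipSum g (b * z)‖) ^ (2 * k1) := mul_pow _ _ _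
    _ ≤ _ := by
        refine mul_le_mul_of_nonneg_left (s4.trans ?_) (by positivity)
        refine mul_le_mul (mul_le_mul (pow_le_pow_left₀ (by positivity) s5 _) s6 (by positivity)
          (by positivity)) s7 (by positivity) ?_
        exact mul_nonneg (by positivity) (recipEnergy_nonneg _ _)

end Bilinear

/-- bilinear Kloosterman sums over intervals in arbitrary position with
`N_1 < p^{(k_1+1)/(2k_1)}`, `N_2 < p^{(k_2+1)/(2k_2)}`. -/
theorem stmt_11 (k1 k2 : ℕ) (hk1 : 0 < k1) (hk2 : 0 < k2) (ε : ℝ) (hε : 0 < ε) :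
    ∃ C : ℝ, 0 < C ∧
      ∀ (p : ℕ), p.Prime → ∀ (a1 a2 : ZMod p) (N1 N2 : ℕ),
        (0 : ZMod p) ∉ interval p a1 N1 →
        (0 : ZMod p) ∉ interval p a2 N2 →
        ((interval p a1 N1).card : ℝ) < (p : ℝ) ^ (((k1 : ℝ) + 1) / (2 * (k1 : ℝ))) →
        ((interval p a2 N2).card : ℝ) < (p : ℝ) ^ (((k2 : ℝ) + 1) / (2 * (k2 : ℝ))) →
        ∀ α1 α2 : ZMod p → ℂ,
          (∀ x ∈ interval p a1 N1, ‖α1 x‖ ≤ 1) →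
          (∀ x ∈ interval p a2 N2, ‖α2 x‖ ≤ 1) →
          ∀ b : ZMod p, b ≠ 0 →
            ‖∑ x1 ∈ interval p a1 N1, ∑ x2 ∈ interval p a2 N2,
                α1 x1 * α2 x2 * ep p (b * x1⁻¹ * x2⁻¹)‖ ≤
              C * ((p : ℝ) ^ ((1 : ℝ) / (2 * (k1 : ℝ) * k2)) *
                  ((interval p a1 N1).card : ℝ) ^ (-(1 : ℝ) / ((k2 : ℝ) * ((k1 : ℝ) + 1))) *
                  ((interval p a2 N2).card : ℝ) ^ (-(1 : ℝ) / ((k1 : ℝ) * ((k2 : ℝ) + 1)))) *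
                (((interval p a1 N1).card : ℝ) * ((interval p a2 N2).card : ℝ)) ^
                  ((1 : ℝ) + ε) := by
  have hk1' : (0 : ℝ) < k1 := by exact_mod_cast hk1
  have hk2' : (0 : ℝ) < k2 := by exact_mod_cast hk2
  have hδ : 0 < 2 * (k1 : ℝ) * k2 * ε := by positivity
  obtain ⟨C1, hC1, hE1⟩ := exists_recipEnergy_interval_le hk1 hδ
  obtain ⟨C2, hC2, hE2⟩ := exists_recipEnergy_interval_le hk2 hδ
  refine ⟨(C1 * C2) ^ ((1 : ℝ) / (2 * (k1 : ℝ) * k2)), by positivity, ?_⟩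
  intro p hp a1 a2 N1 N2 h01 h02 hN1 hN2 α1 α2 hα1 hα2 b hb
  have hpf : Fact p.Prime := ⟨hp⟩
  have hmain := norm_bilinear_pow_le hk1 hk2 _ _ α1 α2 hα1 hα2 hb
  simp_rw [ep_eq_stdAddChar]
  rw [card_interval h01] at hN1 hmain ⊢
  rw [card_interval h02] at hN2 hmain ⊢
  rcases Nat.eq_zero_or_pos N1 with rfl | hN1pos
  · simp only [interval, zero_lt_one, Finset.Icc_eq_empty_of_lt, Finset.image_empty,
      Finset.sum_empty, norm_zero]
    positivity
  rcases Nat.eq_zero_or_pos N2 with rfl | hN2pos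
  · simp only [interval, zero_lt_one, Finset.Icc_eq_empty_of_lt, Finset.image_empty,
      Finset.sum_empty, Finset.sum_const_zero, norm_zero]
    positivity
  have hn1 : (0 : ℝ) < N1 := by exact_mod_cast hN1pos
  have hn2 : (0 : ℝ) < N2 := by exact_mod_cast hN2pos
  have hp0 : (0 : ℝ) < p := by exact_mod_cast hp.pos
  refine le_of_pow_le_pow_left₀ (n := 2 * k1 * k2) (by positivity) (by positivity) ?_
  refine hmain.trans ?_
  have hE1' := hE1 p a1 N1 hN1pos h01 hN1
  have hE2' := hE2 p a2 N2 hN2pos h02 hN2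
  calc _ ≤ ((N1 : ℝ) ^ (k2 - 1)) ^ (2 * k1) * (((N2 : ℝ) ^ k2) ^ (2 * k1 - 2) *
        (C2 * (N2 : ℝ) ^ (2 * (k2 : ℝ) ^ 2 / (k2 + 1) + 2 * (k1 : ℝ) * k2 * ε)) *
        (p * (C1 * (N1 : ℝ) ^ (2 * (k1 : ℝ) ^ 2 / (k1 + 1) + 2 * (k1 : ℝ) * k2 * ε)))) := by
        have := recipEnergy_nonneg k1 (fun x => if x ∈ interval p a1 N1 then 1 else 0)
        gcongr
    _ = (C1 * C2) * p * (N1 : ℝ) ^ (2 * (k1 : ℝ) * k2 * (1 + ε) - 2 * k1 / (k1 + 1)) *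
        (N2 : ℝ) ^ (2 * (k1 : ℝ) * k2 * (1 + ε) - 2 * k2 / (k2 + 1)) := by
        have e1 : ((N1 : ℝ) ^ (k2 - 1)) ^ (2 * k1) *
            (N1 : ℝ) ^ (2 * (k1 : ℝ) ^ 2 / (k1 + 1) + 2 * (k1 : ℝ) * k2 * ε) =
            (N1 : ℝ) ^ (2 * (k1 : ℝ) * k2 * (1 + ε) - 2 * k1 / (k1 + 1)) := by
          rw [← pow_mul, ← Real.rpow_natCast, ← Real.rpow_add hn1]
          congr 1
          rw [Nat.cast_mul, Nat.cast_sub (by omega)]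
          push_cast
          field_simp
          ring
        have e2 : ((N2 : ℝ) ^ k2) ^ (2 * k1 - 2) *
            (N2 : ℝ) ^ (2 * (k2 : ℝ) ^ 2 / (k2 + 1) + 2 * (k1 : ℝ) * k2 * ε) =
            (N2 : ℝ) ^ (2 * (k1 : ℝ) * k2 * (1 + ε) - 2 * k2 / (k2 + 1)) := by
          rw [← pow_mul, ← Real.rpow_natCast, ← Real.rpow_add hn2]
          congr 1
          rw [Nat.cast_mul, Nat.cast_sub (by omega)]
          push_cast
          field_simp
          ring
        rw [← e1, ← e2]
        ring
    _ = _ := by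
        have hK : ((2 * k1 * k2 : ℕ) : ℝ) = 2 * k1 * k2 := by push_cast; rfl
        have root : ∀ x : ℝ, 0 ≤ x →
            (x ^ ((1 : ℝ) / (2 * (k1 : ℝ) * k2))) ^ (2 * k1 * k2) = x := by
          intro x hx
          rw [← Real.rpow_natCast, ← Real.rpow_mul hx, hK, one_div_mul_cancel (by positivity),
            Real.rpow_one]
        have e1 : ((N1 : ℝ) ^ (-(1 : ℝ) / ((k2 : ℝ) * ((k1 : ℝ) + 1)))) ^ (2 * k1 * k2) *
            ((N1 : ℝ) ^ (1 + ε)) ^ (2 * k1 * k2) =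
            (N1 : ℝ) ^ (2 * (k1 : ℝ) * k2 * (1 + ε) - 2 * k1 / (k1 + 1)) := by
          rw [← Real.rpow_natCast, ← Real.rpow_natCast, ← Real.rpow_mul hn1.le,
            ← Real.rpow_mul hn1.le, ← Real.rpow_add hn1, hK]
          congr 1
          field_simp
          ring
        have e2 : ((N2 : ℝ) ^ (-(1 : ℝ) / ((k1 : ℝ) * ((k2 : ℝ) + 1)))) ^ (2 * k1 * k2) *
            ((N2 : ℝ) ^ (1 + ε)) ^ (2 * k1 * k2) =
            (N2 : ℝ) ^ (2 * (k1 : ℝ) * k2 * (1 + ε) - 2 * k2 / (k2 + 1)) := by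
          rw [← Real.rpow_natCast, ← Real.rpow_natCast, ← Real.rpow_mul hn2.le,
            ← Real.rpow_mul hn2.le, ← Real.rpow_add hn2, hK]
          congr 1
          field_simp
          ring
        rw [Real.mul_rpow hn1.le hn2.le]
        simp only [mul_pow]
        rw [root _ (by positivity), root _ (by positivity), ← e1, ← e2]
        ring
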